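/- There exist constants δ, D > 0 and a positive integer Q such that the following holds for Thompson's group F. For every g ∈ F with N(g) ≥ 4 there is a word w in the letters {x0^{±1}, x1^{±1}} of length at most D·|g|_A such that g·w = x0^{Q·|g|_A}·x1^{−1}·x0^{−Q·|g|_A+1} as elements of F, and for every prefix w' of w (evaluated as an element of F) one has |g·w'|_A > δ·|g|_A. -/

import Mathlib

/-!
Formalization framework for Thompson's groups `F ≤ T ≤ V` acting on the
Cantor set `{0,1}^ℕ`.  Elements of `V` are permutations of the Cantor set
admitting a finite table of branches `u → v` (complete prefix codes) with
`g(uω) = vω`.  Products in the paper are composed left-to-right, i.e. the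
paper's `g·h` is `Equiv.trans g h` (equivalently `h * g` in `Equiv.Perm`).
-/

abbrev CSeq : Type := ℕ → Bool
abbrev VPerm : Type := Equiv.Perm CSeq

/-- Concatenation of a finite binary word with an infinite binary word. -/
def app (u : List Bool) (ω : CSeq) : CSeq := fun n =>
  if h : n < u.length then u[n] else ω (n - u.length)

/-- The finite word `u` is a prefix of the infinite word `ω`. -/
def IsPref (u : List Bool) (ω : CSeq) : Prop := ∃ ω', ω = app u ω'

/-- The finite table of branches `T` represents the permutation `g` of the
Cantor set: the domain codes and the range codes each form a complete prefix
code, and `g` maps `uω ↦ vω` for every branch `(u, v) ∈ T`. -/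
def Represents (g : VPerm) (T : Finset (List Bool × List Bool)) : Prop :=
  (∀ ω : CSeq, ∃! p : List Bool × List Bool, p ∈ T ∧ IsPref p.1 ω) ∧
  (∀ ω : CSeq, ∃! p : List Bool × List Bool, p ∈ T ∧ IsPref p.2 ω) ∧
  (∀ p ∈ T, ∀ ω : CSeq, g (app p.1 ω) = app p.2 ω)

/-- A table of branches is reduced if it contains no pair of branches
`u0 → v0`, `u1 → v1`. -/
def Reduced (T : Finset (List Bool × List Bool)) : Prop :=
  ∀ u v : List Bool,
    ¬((u ++ [false], v ++ [false]) ∈ T ∧ (u ++ [true], v ++ [true]) ∈ T)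

/-- Membership in Thompson's group `V`. -/
def InV (g : VPerm) : Prop := ∃ T, Represents g T

/-- `u → v` is a branch of the (unique) reduced representation of `g`. -/
def IsBranch (g : VPerm) (u v : List Bool) : Prop :=
  ∃ T, Represents g T ∧ Reduced T ∧ (u, v) ∈ T

/-- `N(g)`: the number of branches of the reduced representation of `g`. -/
noncomputable def Nbr (g : VPerm) : ℕ :=
  sInf {n | ∃ T, Represents g T ∧ Reduced T ∧ T.card = n}

/-- `ℓ0(g)`: the unique `ℓ ≥ 1` such that `0^ℓ` is the range code of some
branch of `g`. -/
noncomputable def ell0 (g : VPerm) : ℕ :=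
  sInf {ℓ | 1 ≤ ℓ ∧ ∃ u, IsBranch g u (List.replicate ℓ false)}

/-- `ℓ1(g)`: the unique `ℓ ≥ 1` such that `1^ℓ` is the range code of some
branch of `g`. -/
noncomputable def ell1 (g : VPerm) : ℕ :=
  sInf {ℓ | 1 ≤ ℓ ∧ ∃ u, IsBranch g u (List.replicate ℓ true)}

/-- `w` is a strict prefix of the range code of some branch of `g`. -/
def StrictPrefOfBranch (g : VPerm) (w : List Bool) : Prop :=
  ∃ u v, IsBranch g u v ∧ w <+: v ∧ w ≠ v

/-- Strict lexicographic order on infinite binary words. -/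
def lexLt (a b : CSeq) : Prop :=
  ∃ n, (∀ i < n, a i = b i) ∧ a n = false ∧ b n = true

/-- Membership in Thompson's group `F`: an element of `V` preserving the
(lexicographic) order of the Cantor set. -/
def InF (g : VPerm) : Prop :=
  InV g ∧ ∀ a b : CSeq, lexLt a b → lexLt (g a) (g b)

/-- `(a, b, c)` is a (strict) cyclically ordered triple. -/
def cyc3 (a b c : CSeq) : Prop :=
  (lexLt a b ∧ lexLt b c) ∨ (lexLt b c ∧ lexLt c a) ∨ (lexLt c a ∧ lexLt a b)

/-- Membership in Thompson's group `T`: an element of `V` preserving the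
cyclic order of the Cantor set. -/
def InT (g : VPerm) : Prop :=
  InV g ∧ ∀ a b c : CSeq, cyc3 a b c → cyc3 (g a) (g b) (g c)

/-- Word length of `g` with respect to the generating set `S` (letters are
elements of `S` or inverses of elements of `S`). -/
noncomputable def wlen (S : Set VPerm) (g : VPerm) : ℕ :=
  sInf {n | ∃ l : List VPerm,
    l.length = n ∧ (∀ x ∈ l, x ∈ S ∨ x⁻¹ ∈ S) ∧ l.prod = g}

/-- `h'` is the copy `h_{[u]}` of `h` supported on the cylinder of `u`. -/
def IsCopy (h : VPerm) (u : List Bool) (h' : VPerm) : Prop :=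
  (∀ ω : CSeq, h' (app u ω) = app u (h ω)) ∧
  (∀ ω : CSeq, ¬ IsPref u ω → h' ω = ω)

/-- Evaluation (left-to-right) of the word `w` starting at the element `g`:
the paper's product `g · w`. -/
def wordEval (g : VPerm) (w : List VPerm) : VPerm :=
  w.foldl (fun a b => a.trans b) g

/-- Branches of the generator `x0`: `00→0`, `01→10`, `1→11`. -/
def x0T : Finset (List Bool × List Bool) :=
  {([false, false], [false]), ([false, true], [true, false]),
   ([true], [true, true])}

/-- Branches of the generator `x1`: `0→0`, `100→10`, `101→110`, `11→111`. -/
def x1T : Finset (List Bool × List Bool) :=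
  {([false], [false]), ([true, false, false], [true, false]),
   ([true, false, true], [true, true, false]),
   ([true, true], [true, true, true])}

/-- Branches of the generator `c1`: `0→10`, `10→11`, `11→0`. -/
def c1T : Finset (List Bool × List Bool) :=
  {([false], [true, false]), ([true, false], [true, true]),
   ([true, true], [false])}

/-- Branches of the generator `π0`: `0→10`, `10→0`, `11→11`. -/
def pi0T : Finset (List Bool × List Bool) :=
  {([false], [true, false]), ([true, false], [false]),
   ([true, true], [true, true])}

/-- The standard generators `x_j`, `j ≥ 0`, of `F`: for `r ≥ 1`,
`x_{r+1} = x0^{-r} · x1 · x0^{r}` in the left-to-right convention of the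
paper, i.e. `x0 ^ r * x1 * (x0⁻¹) ^ r` in `Equiv.Perm`. -/
def xseq (x0 x1 : VPerm) : ℕ → VPerm
  | 0 => x0
  | r + 1 => x0 ^ r * x1 * (x0⁻¹) ^ r

/-- The infinite word obtained by prepending the letter `b` to `ω`. -/
def cns (b : Bool) (ω : CSeq) : CSeq := app [b] ω

theorem app_nil (ω : CSeq) : app [] ω = ω := by
  funext n; simp [app]

theorem app_cons (b : Bool) (u : List Bool) (ω : CSeq) :
    app (b :: u) ω = cns b (app u ω) := by
  funext n
  cases n with
  | zero => simp [app, cns]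
  | succ n => simp [app, cns]

theorem app_append (u v : List Bool) (ω : CSeq) : app (u ++ v) ω = app u (app v ω) := by
  induction u with
  | nil => simp [app_nil]
  | cons b u ih => simp [app_cons, ih]

theorem cns_zero (b : Bool) (ω : CSeq) : cns b ω 0 = b := by simp [cns, app]

theorem cns_succ (b : Bool) (ω : CSeq) (n : ℕ) : cns b ω (n + 1) = ω n := by simp [cns, app]

theorem cns_inj {b b' : Bool} {ω ω' : CSeq} : cns b ω = cns b' ω' ↔ b = b' ∧ ω = ω' := by
  constructor
  · intro h
    refine ⟨by simpa [cns_zero] using congrFun h 0, funext fun n => ?_⟩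
    simpa [cns_succ] using congrFun h (n + 1)
  · rintro ⟨rfl, rfl⟩; rfl

theorem exists_cns (ω : CSeq) : ∃ b ω', ω = cns b ω' := by
  refine ⟨ω 0, fun n => ω (n + 1), funext fun n => ?_⟩
  cases n with
  | zero => rw [cns_zero]
  | succ n => rw [cns_succ]

theorem app_injective (u : List Bool) : Function.Injective (app u) := by
  induction u with
  | nil => intro a b h; simpa [app_nil] using h
  | cons c u ih => intro a b h; exact ih (by simpa [app_cons, cns_inj] using h)

theorem perm_apply_inv_apply (g : VPerm) (ω : CSeq) : g (g⁻¹ ω) = ω := Equiv.apply_symm_apply g ω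

theorem perm_inv_apply_apply (g : VPerm) (ω : CSeq) : g⁻¹ (g ω) = ω := Equiv.symm_apply_apply g ω

/-- The action of the two standard generators of `F`, letter by letter. -/
structure Gens (x0 x1 : VPerm) : Prop where
  x0_ff : ∀ ω, x0 (cns false (cns false ω)) = cns false ω
  x0_ft : ∀ ω, x0 (cns false (cns true ω)) = cns true (cns false ω)
  x0_t : ∀ ω, x0 (cns true ω) = cns true (cns true ω)
  x1_f : ∀ ω, x1 (cns false ω) = cns false ω
  x1_t : ∀ ω, x1 (cns true ω) = cns true (x0 ω)

theorem gens_of_represents {x0 x1 : VPerm} (hx0 : Represents x0 x0T)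
    (hx1 : Represents x1 x1T) : Gens x0 x1 := by
  have h0 := hx0.2.2
  have h1 := hx1.2.2
  simp only [x0T, x1T, Finset.mem_insert, Finset.mem_singleton, forall_eq_or_imp, forall_eq,
    app_cons, app_nil] at h0 h1
  obtain ⟨a, b, c⟩ := h0
  obtain ⟨d, e, f, k⟩ := h1
  refine ⟨a, b, c, d, fun ω => ?_⟩
  obtain ⟨p, ω, rfl⟩ := exists_cns ω
  cases p
  · obtain ⟨q, ω, rfl⟩ := exists_cns ω
    cases q
    · rw [e, a]
    · rw [f, b]
  · rw [k, c]

namespace Gens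

variable {x0 x1 : VPerm}

theorem x0_inv_f (G : Gens x0 x1) (ω : CSeq) :
    x0⁻¹ (cns false ω) = cns false (cns false ω) := by
  rw [Equiv.Perm.inv_eq_iff_eq, G.x0_ff]

theorem x0_inv_tf (G : Gens x0 x1) (ω : CSeq) :
    x0⁻¹ (cns true (cns false ω)) = cns false (cns true ω) := by
  rw [Equiv.Perm.inv_eq_iff_eq, G.x0_ft]

theorem x0_inv_tt (G : Gens x0 x1) (ω : CSeq) :
    x0⁻¹ (cns true (cns true ω)) = cns true ω := by
  rw [Equiv.Perm.inv_eq_iff_eq, G.x0_t]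

theorem x1_inv_f (G : Gens x0 x1) (ω : CSeq) : x1⁻¹ (cns false ω) = cns false ω := by
  rw [Equiv.Perm.inv_eq_iff_eq, G.x1_f]

theorem x1_inv_t (G : Gens x0 x1) (ω : CSeq) : x1⁻¹ (cns true ω) = cns true (x0⁻¹ ω) := by
  rw [Equiv.Perm.inv_eq_iff_eq, G.x1_t, perm_apply_inv_apply]

end Gens

/-- The subgroup generated by the two given permutations. -/
def genF (x0 x1 : VPerm) : Subgroup VPerm := Subgroup.closure {x0, x1}

theorem x0_mem_genF (x0 x1 : VPerm) : x0 ∈ genF x0 x1 := Subgroup.subset_closure (by simp)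

theorem x1_mem_genF (x0 x1 : VPerm) : x1 ∈ genF x0 x1 := Subgroup.subset_closure (by simp)

/-- `h'` acts as `h` below the letter `b` and trivially below the other letter. -/
def ActsBelow (b : Bool) (h h' : VPerm) : Prop :=
  (∀ ω, h' (cns b ω) = cns b (h ω)) ∧ ∀ ω, h' (cns (!b) ω) = cns (!b) ω

theorem exists_actsBelow {x0 x1 : VPerm} {b : Bool}
    (h0 : ∃ h' ∈ genF x0 x1, ActsBelow b x0 h') (h1 : ∃ h' ∈ genF x0 x1, ActsBelow b x1 h')
    {h : VPerm} (hh : h ∈ genF x0 x1) : ∃ h' ∈ genF x0 x1, ActsBelow b h h' := by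
  unfold genF at hh
  induction hh using Subgroup.closure_induction with
  | mem x hx =>
    rcases hx with rfl | hx
    · exact h0
    · rw [Set.mem_singleton_iff] at hx
      exact hx ▸ h1
  | one => exact ⟨1, one_mem _, fun ω => rfl, fun ω => rfl⟩
  | mul x y _ _ ihx ihy =>
    obtain ⟨x', hx', hx1, hx2⟩ := ihx
    obtain ⟨y', hy', hy1, hy2⟩ := ihy
    exact ⟨x' * y', mul_mem hx' hy', fun ω => by simp [hx1, hy1], fun ω => by simp [hx2, hy2]⟩
  | inv x _ ihx =>
    obtain ⟨x', hx', hx1, hx2⟩ := ihx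
    refine ⟨x'⁻¹, inv_mem hx', fun ω => ?_, fun ω => ?_⟩
    · rw [Equiv.Perm.inv_eq_iff_eq, hx1, perm_apply_inv_apply]
    · rw [Equiv.Perm.inv_eq_iff_eq, hx2]

namespace Gens

variable {x0 x1 : VPerm}

theorem actsBelow_true (G : Gens x0 x1) {h : VPerm} (hh : h ∈ genF x0 x1) :
    ∃ h' ∈ genF x0 x1, ActsBelow true h h' := by
  have m0 := x0_mem_genF x0 x1
  have m1 := x1_mem_genF x0 x1
  refine exists_actsBelow ⟨x1, m1, G.x1_t, G.x1_f⟩ ⟨x0 * x1 * x0⁻¹, ?_, ?_, ?_⟩ hh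
  · exact mul_mem (mul_mem m0 m1) (inv_mem m0)
  · intro ω
    obtain ⟨b, ω, rfl⟩ := exists_cns ω
    cases b <;> simp only [Equiv.Perm.mul_apply, G.x0_inv_tf, G.x0_inv_tt, G.x0_ft, G.x0_t, G.x1_f,
      G.x1_t]
  · intro ω
    simp only [Bool.not_true, Equiv.Perm.mul_apply, G.x0_inv_f, G.x1_f, G.x0_ff]

theorem actsBelow_false_x0 (G : Gens x0 x1) :
    ActsBelow false x0 (x0⁻¹ * x1⁻¹ * x0 * x0) := by
  refine ⟨fun ω => ?_, fun ω => ?_⟩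
  · obtain ⟨b, ω, rfl⟩ := exists_cns ω
    cases b
    · obtain ⟨b, ω, rfl⟩ := exists_cns ω
      cases b <;> simp only [Equiv.Perm.mul_apply, G.x0_inv_f, G.x0_inv_tf, G.x0_ff,
        G.x0_ft, G.x1_inv_f, G.x1_inv_t]
    · simp only [Equiv.Perm.mul_apply, G.x0_inv_tf, G.x0_ft, G.x0_t, G.x1_inv_t]
  · simp only [Bool.not_false, Equiv.Perm.mul_apply, G.x0_inv_tt, G.x0_t, G.x1_inv_t]

theorem actsBelow_false (G : Gens x0 x1) {h : VPerm} (hh : h ∈ genF x0 x1) :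
    ∃ h' ∈ genF x0 x1, ActsBelow false h h' := by
  have m0 := x0_mem_genF x0 x1
  have m1 := x1_mem_genF x0 x1
  have my : x0⁻¹ * x1⁻¹ * x0 * x0 ∈ genF x0 x1 :=
    mul_mem (mul_mem (mul_mem (inv_mem m0) (inv_mem m1)) m0) m0
  obtain ⟨z, hz, hz1, hz2⟩ := G.actsBelow_true my
  obtain ⟨hy1, hy2⟩ := G.actsBelow_false_x0
  simp only [Bool.not_true, Bool.not_false] at hz2 hy2
  refine exists_actsBelow ⟨_, my, G.actsBelow_false_x0⟩ ⟨x0⁻¹ * z * x0, ?_, ?_, ?_⟩ hh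
  · exact mul_mem (mul_mem (inv_mem m0) hz) m0
  · intro ω
    obtain ⟨b, ω, rfl⟩ := exists_cns ω
    cases b
    · rw [Equiv.Perm.mul_apply, Equiv.Perm.mul_apply, G.x0_ff, hz2, G.x0_inv_f, G.x1_f]
    · rw [Equiv.Perm.mul_apply, Equiv.Perm.mul_apply, G.x0_ft, hz1, hy1, G.x0_inv_tf, G.x1_t]
  · intro ω
    rw [Bool.not_false, Equiv.Perm.mul_apply, Equiv.Perm.mul_apply, G.x0_t, hz1, hy2,
      G.x0_inv_tt]

end Gens

/-- Finite rooted binary trees. -/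
inductive BinTree : Type
  | leaf : BinTree
  | node : BinTree → BinTree → BinTree

namespace BinTree

/-- The addresses of the leaves, from left to right. -/
def leaves : BinTree → List (List Bool)
  | leaf => [[]]
  | node l r => l.leaves.map (List.cons false) ++ r.leaves.map (List.cons true)

/-- The number of inner nodes. -/
def size : BinTree → ℕ
  | leaf => 0
  | node l r => l.size + r.size + 1

/-- The right-leaning tree with `n` inner nodes. -/
def vine : ℕ → BinTree
  | 0 => leaf
  | n + 1 => node leaf (vine n)

/-- The complete tree of depth `n`. -/
def full : ℕ → BinTree
  | 0 => leaf
  | n + 1 => node (full n) (full n)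

theorem length_leaves (S : BinTree) : S.leaves.length = S.size + 1 := by
  induction S with
  | leaf => rfl
  | node l r ihl ihr => simp [leaves, size, ihl, ihr]; omega

theorem length_of_mem_leaves_full {n : ℕ} {u : List Bool} (hu : u ∈ (full n).leaves) :
    u.length = n := by
  induction n generalizing u with
  | zero => simp_all [full, leaves]
  | succ n ih =>
    simp only [full, leaves, List.mem_append, List.mem_map] at hu
    rcases hu with ⟨v, hv, rfl⟩ | ⟨v, hv, rfl⟩ <;> simp [ih hv]

theorem exists_leaf (S : BinTree) (ω : CSeq) : ∃ u ∈ S.leaves, ∃ ω', ω = app u ω' := by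
  induction S generalizing ω with
  | leaf => exact ⟨[], by simp [leaves], ω, (app_nil ω).symm⟩
  | node l r ihl ihr =>
    obtain ⟨b, ω, rfl⟩ := exists_cns ω
    cases b
    · obtain ⟨u, hu, ω', rfl⟩ := ihl ω
      exact ⟨false :: u, by simp [leaves, hu], ω', (app_cons ..).symm⟩
    · obtain ⟨u, hu, ω', rfl⟩ := ihr ω
      exact ⟨true :: u, by simp [leaves, hu], ω', (app_cons ..).symm⟩

end BinTree

/-- `h` maps the cylinder of `u` onto that of `v` by exchanging prefixes. -/
def MapsPref (h : VPerm) (u v : List Bool) : Prop := ∀ ω, h (app u ω) = app v ω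

/-- Some element of `genF x0 x1` maps the leaves of `S` in order to those of `T`. -/
def TreeRel (x0 x1 : VPerm) (S T : BinTree) : Prop :=
  ∃ h ∈ genF x0 x1, List.Forall₂ (MapsPref h) S.leaves T.leaves

namespace TreeRel

open BinTree

variable {x0 x1 : VPerm} {S T U S' T' : BinTree}

theorem refl (x0 x1 : VPerm) (S : BinTree) : TreeRel x0 x1 S S :=
  ⟨1, one_mem _, List.forall₂_same.2 fun _ _ _ => rfl⟩

theorem symm (h : TreeRel x0 x1 S T) : TreeRel x0 x1 T S := by
  obtain ⟨h, hh, H⟩ := h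
  refine ⟨h⁻¹, inv_mem hh, List.Forall₂.flip (H.imp fun u v huv ω => ?_)⟩
  rw [Equiv.Perm.inv_eq_iff_eq, huv]

theorem trans (h : TreeRel x0 x1 S T) (h' : TreeRel x0 x1 T U) : TreeRel x0 x1 S U := by
  obtain ⟨h, hh, H⟩ := h
  obtain ⟨k, hk, K⟩ := h'
  refine ⟨k * h, mul_mem hk hh, ?_⟩
  generalize S.leaves = a at *
  generalize T.leaves = b at *
  generalize U.leaves = c at *
  clear hh hk
  induction H generalizing c with
  | nil => cases K; exact .nil
  | cons hab _ ih =>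
    cases K with
    | cons hbc K => exact .cons (fun ω => by rw [Equiv.Perm.mul_apply, hab, hbc]) (ih _ K)

theorem node (G : Gens x0 x1) (h : TreeRel x0 x1 S T) (h' : TreeRel x0 x1 S' T') :
    TreeRel x0 x1 (node S S') (node T T') := by
  obtain ⟨h, hh, H⟩ := h
  obtain ⟨k, hk, K⟩ := h'
  obtain ⟨p, hp, hp1, hp2⟩ := G.actsBelow_false hh
  obtain ⟨q, hq, hq1, hq2⟩ := G.actsBelow_true hk
  simp only [Bool.not_false, Bool.not_true] at hp2 hq2
  refine ⟨p * q, mul_mem hp hq, List.rel_append ?_ ?_⟩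
  · rw [List.forall₂_map_left_iff, List.forall₂_map_right_iff]
    refine H.imp fun u v huv ω => ?_
    rw [app_cons, app_cons, Equiv.Perm.mul_apply, hq2, hp1, huv]
  · rw [List.forall₂_map_left_iff, List.forall₂_map_right_iff]
    refine K.imp fun u v huv ω => ?_
    rw [app_cons, app_cons, Equiv.Perm.mul_apply, hq1, huv, hp2]

theorem assoc (G : Gens x0 x1) (S T U : BinTree) :
    TreeRel x0 x1 (.node (.node S T) U) (.node S (.node T U)) := by
  refine ⟨x0, x0_mem_genF _ _, ?_⟩
  simp only [leaves, List.map_append, List.map_map, List.append_assoc]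
  refine List.rel_append ?_ (List.rel_append ?_ ?_) <;>
  · rw [List.forall₂_map_left_iff, List.forall₂_map_right_iff]
    refine List.forall₂_same.2 fun u _ ω => ?_
    simp [app_cons, G.x0_ff, G.x0_ft, G.x0_t]

theorem node_vine (G : Gens x0 x1) (a b : ℕ) :
    TreeRel x0 x1 (.node (vine a) (vine b)) (vine (a + b + 1)) := by
  induction a with
  | zero => rw [Nat.zero_add]; exact refl x0 x1 _
  | succ a ih =>
    rw [show a + 1 + b + 1 = (a + b + 1) + 1 by omega]
    exact (assoc G _ _ _).trans (node G (refl x0 x1 _) ih)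

theorem vine_size (G : Gens x0 x1) (S : BinTree) : TreeRel x0 x1 S (vine S.size) := by
  induction S with
  | leaf => exact refl x0 x1 _
  | node l r ihl ihr => exact (node G ihl ihr).trans (node_vine G _ _)

theorem of_length_leaves_eq (G : Gens x0 x1) (h : S.leaves.length = T.leaves.length) :
    TreeRel x0 x1 S T := by
  rw [length_leaves, length_leaves, Nat.add_right_cancel_iff] at h
  exact (vine_size G S).trans (h ▸ (vine_size G T).symm)

end TreeRel

theorem lexLt_irrefl (a : CSeq) : ¬ lexLt a a := by
  rintro ⟨n, -, h, h'⟩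
  simp [h] at h'

theorem lexLt_cns {b : Bool} {x y : CSeq} : lexLt (cns b x) (cns b y) ↔ lexLt x y := by
  constructor
  · rintro ⟨n, h, h0, h1⟩
    cases n with
    | zero => simp_all [cns_zero]
    | succ n =>
      refine ⟨n, fun i hi => ?_, by simpa [cns_succ] using h0, by simpa [cns_succ] using h1⟩
      simpa [cns_succ] using h (i + 1) (by omega)
  · rintro ⟨n, h, h0, h1⟩
    refine ⟨n + 1, fun i hi => ?_, by simpa [cns_succ] using h0, by simpa [cns_succ] using h1⟩
    cases i with
    | zero => simp [cns_zero]
    | succ i => simpa [cns_succ] using h i (by omega)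

theorem lexLt_false_true (x y : CSeq) : lexLt (cns false x) (cns true y) :=
  ⟨0, by simp, by simp [cns_zero], by simp [cns_zero]⟩

theorem not_lexLt_true_false (x y : CSeq) : ¬ lexLt (cns true x) (cns false y) := by
  rintro ⟨n, h, h0, h1⟩
  cases n with
  | zero => simp [cns_zero] at h0
  | succ n => simpa [cns_zero] using h 0 (by omega)

/-- The cylinder of `u` lies to the left of that of `v`. -/
def LeftOf (u v : List Bool) : Prop := ∀ x y, lexLt (app u x) (app v y)

theorem leftOf_cons {b : Bool} {u v : List Bool} :
    LeftOf (b :: u) (b :: v) ↔ LeftOf u v := by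
  simp [LeftOf, app_cons, lexLt_cns]

theorem not_leftOf_nil_left (v : List Bool) : ¬ LeftOf [] v := fun h =>
  lexLt_irrefl _ (by simpa [app_nil] using h (app v fun _ => false) fun _ => false)

theorem not_leftOf_nil_right (v : List Bool) : ¬ LeftOf v [] := fun h =>
  lexLt_irrefl _ (by simpa [app_nil] using h (fun _ => false) (app v fun _ => false))

theorem BinTree.pairwise_leaves (S : BinTree) : S.leaves.Pairwise LeftOf := by
  induction S with
  | leaf => simp [leaves]
  | node l r ihl ihr =>
    simp only [leaves, List.pairwise_append, List.pairwise_map, leftOf_cons, ihl, ihr, true_and]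
    intro u hu v hv
    obtain ⟨u, -, rfl⟩ := List.mem_map.1 hu
    obtain ⟨v, -, rfl⟩ := List.mem_map.1 hv
    intro x y
    rw [app_cons, app_cons]
    exact lexLt_false_true _ _

theorem exists_eq_map_append_map {L : List (List Bool)} (hne : [] ∉ L)
    (hL : L.Pairwise LeftOf) :
    ∃ A B : List (List Bool), L = A.map (List.cons false) ++ B.map (List.cons true) := by
  induction L with
  | nil => exact ⟨[], [], rfl⟩
  | cons u L ih =>
    rw [List.pairwise_cons] at hL
    obtain ⟨A, B, rfl⟩ := ih (fun h => hne (List.mem_cons_of_mem _ h)) hL.2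
    match u, hne, hL with
    | [], hne, _ => simp at hne
    | false :: u, _, _ => exact ⟨u :: A, B, rfl⟩
    | true :: u, _, hL =>
      cases A with
      | nil => exact ⟨[], u :: B, rfl⟩
      | cons a A =>
        have := hL.1 (false :: a) (by simp) (fun _ => false) (fun _ => false)
        rw [app_cons, app_cons] at this
        exact absurd this (not_lexLt_true_false _ _)

theorem exists_leaves_eq (d : ℕ) {L : List (List Bool)} (hd : ∀ u ∈ L, u.length ≤ d)
    (hL : L.Pairwise LeftOf) (hcov : ∀ ω, ∃ u ∈ L, ∃ ω', ω = app u ω') :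
    ∃ S : BinTree, S.leaves = L := by
  induction d generalizing L with
  | zero =>
    obtain ⟨u, hu, -⟩ := hcov fun _ => false
    have hL' : ∀ v ∈ L, v = [] := fun v hv =>
      List.length_eq_zero_iff.1 (Nat.le_zero.1 (hd v hv))
    match L, hL, hL', hu with
    | [v], _, h, _ => exact ⟨.leaf, by simp [BinTree.leaves, h v (by simp)]⟩
    | v :: v' :: _, hL, h, _ =>
      rw [h v (by simp), List.pairwise_cons] at hL
      exact absurd (hL.1 v' (by simp)) (not_leftOf_nil_left _)
  | succ d ih =>
    by_cases hnil : [] ∈ L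
    · obtain ⟨A, B, rfl⟩ := List.append_of_mem hnil
      refine ⟨.leaf, ?_⟩
      rw [List.pairwise_append, List.pairwise_cons] at hL
      have hB : B = [] := List.eq_nil_iff_forall_not_mem.2 fun v hv =>
        not_leftOf_nil_left v (hL.2.1.1 v hv)
      have hA : A = [] := List.eq_nil_iff_forall_not_mem.2 fun v hv =>
        not_leftOf_nil_right v (hL.2.2 v hv [] (by simp))
      simp [hA, hB, BinTree.leaves]
    · obtain ⟨A, B, rfl⟩ := exists_eq_map_append_map hnil hL
      simp only [List.pairwise_append, List.pairwise_map, leftOf_cons] at hL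
      obtain ⟨S, hS⟩ := ih (L := A) (fun u hu => by simpa using hd (false :: u) (by simp [hu]))
        hL.1 fun ω => by
          obtain ⟨u, hu, ω', h⟩ := hcov (cns false ω)
          rcases List.mem_append.1 hu with hu | hu <;> obtain ⟨v, hv, rfl⟩ := List.mem_map.1 hu
          · exact ⟨v, hv, ω', by simpa [app_cons, cns_inj] using h⟩
          · simp [app_cons, cns_inj] at h
      obtain ⟨T, hT⟩ := ih (L := B) (fun u hu => by simpa using hd (true :: u) (by simp [hu]))
        hL.2.1 fun ω => by
          obtain ⟨u, hu, ω', h⟩ := hcov (cns true ω)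
          rcases List.mem_append.1 hu with hu | hu <;> obtain ⟨v, hv, rfl⟩ := List.mem_map.1 hu
          · simp [app_cons, cns_inj] at h
          · exact ⟨v, hv, ω', by simpa [app_cons, cns_inj] using h⟩
      exact ⟨.node S T, by rw [BinTree.leaves, hS, hT]⟩

theorem prefix_of_app_eq_app {p u : List Bool} {x y : CSeq} (h : app u x = app p y)
    (hl : p.length ≤ u.length) : p <+: u := by
  induction p generalizing u with
  | nil => exact List.nil_prefix
  | cons b p ih =>
    cases u with
    | nil => simp at hl
    | cons c u =>
      rw [app_cons, app_cons, cns_inj] at h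
      obtain ⟨rfl, h⟩ := h
      exact (List.prefix_cons_inj _).2 (ih h (by simpa using hl))

theorem mem_genF {x0 x1 g : VPerm} (G : Gens x0 x1) (hg : InF g) : g ∈ genF x0 x1 := by
  obtain ⟨⟨T, hT⟩, hmono⟩ := hg
  set d := T.sup fun p => p.1.length
  have key : ∀ u : List Bool, ∃ v, u.length = d → MapsPref g u v := by
    intro u
    by_cases hu : u.length = d
    · obtain ⟨p, ⟨hp, ω, hω⟩, -⟩ := hT.1 (app u fun _ => false)
      have hle : p.1.length ≤ u.length :=
        hu ▸ Finset.le_sup (f := fun p : List Bool × List Bool => p.1.length) hp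
      obtain ⟨r, rfl⟩ := prefix_of_app_eq_app hω hle
      exact ⟨p.2 ++ r, fun _ ω => by rw [app_append, app_append, hT.2.2 p hp]⟩
    · exact ⟨[], fun h => absurd h hu⟩
  choose φ hφ using key
  have hφ' : ∀ u ∈ (BinTree.full d).leaves, MapsPref g u (φ u) := fun u hu =>
    hφ u (BinTree.length_of_mem_leaves_full hu)
  set L := (BinTree.full d).leaves.map φ with hLdef
  have hpair : L.Pairwise LeftOf := by
    rw [hLdef, List.pairwise_map]
    refine (BinTree.full d).pairwise_leaves.imp_of_mem fun hu hv h x y => ?_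
    rw [← hφ' _ hu, ← hφ' _ hv]
    exact hmono _ _ (h x y)
  have hcov : ∀ ω, ∃ u ∈ L, ∃ ω', ω = app u ω' := by
    intro ω
    obtain ⟨u, hu, ω', h⟩ := (BinTree.full d).exists_leaf (g⁻¹ ω)
    refine ⟨φ u, List.mem_map_of_mem hu, ω', ?_⟩
    rw [← hφ' u hu, ← h, perm_apply_inv_apply]
  obtain ⟨S, hS⟩ := exists_leaves_eq (L.map List.length).sum
    (fun u hu => List.le_sum_of_mem (List.mem_map_of_mem hu)) hpair hcov
  obtain ⟨h, hh, H⟩ := TreeRel.of_length_leaves_eq G (S := BinTree.full d) (T := S)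
    (by rw [hS, hLdef, List.length_map])
  rw [hS, hLdef, List.forall₂_map_right_iff, List.forall₂_same] at H
  have : g = h := by
    ext1 ω
    obtain ⟨u, hu, ω, rfl⟩ := (BinTree.full d).exists_leaf ω
    rw [hφ' u hu, H u hu]
  exact this ▸ hh

/-- `x` is one of the four letters `x0^{±1}`, `x1^{±1}`. -/
def Letter (x0 x1 x : VPerm) : Prop := x = x0 ∨ x = x0⁻¹ ∨ x = x1 ∨ x = x1⁻¹

theorem letter_iff {x0 x1 x : VPerm} :
    Letter x0 x1 x ↔ x ∈ ({x0, x1} : Set VPerm) ∨ x⁻¹ ∈ ({x0, x1} : Set VPerm) := by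
  simp only [Letter, Set.mem_insert_iff, Set.mem_singleton_iff, inv_eq_iff_eq_inv]
  tauto

theorem Letter.inv {x0 x1 x : VPerm} (h : Letter x0 x1 x) : Letter x0 x1 x⁻¹ := by
  rw [letter_iff] at *
  rw [inv_inv]
  exact h.symm

section WordLength

variable {x0 x1 g h : VPerm}

theorem exists_word (hg : g ∈ genF x0 x1) : ∃ l : List VPerm,
    l.length = wlen {x0, x1} g ∧ (∀ x ∈ l, Letter x0 x1 x) ∧ l.prod = g := by
  simp only [letter_iff]
  refine Nat.sInf_mem (s := {n | ∃ l : List VPerm, l.length = n ∧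
    (∀ x ∈ l, x ∈ ({x0, x1} : Set VPerm) ∨ x⁻¹ ∈ ({x0, x1} : Set VPerm)) ∧ l.prod = g}) ?_
  rw [genF, ← Subgroup.mem_toSubmonoid, Subgroup.closure_toSubmonoid] at hg
  obtain ⟨l, hl, hp⟩ := Submonoid.exists_list_of_mem_closure hg
  exact ⟨l.length, l, rfl, hl, hp⟩

theorem wlen_prod_le {l : List VPerm} (hl : ∀ x ∈ l, Letter x0 x1 x) :
    wlen {x0, x1} l.prod ≤ l.length :=
  Nat.sInf_le ⟨l, rfl, fun x hx => letter_iff.1 (hl x hx), rfl⟩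

theorem wlen_mul_le (hg : g ∈ genF x0 x1) (hh : h ∈ genF x0 x1) :
    wlen {x0, x1} (g * h) ≤ wlen {x0, x1} g + wlen {x0, x1} h := by
  obtain ⟨l, hl, hl', rfl⟩ := exists_word hg
  obtain ⟨k, hk, hk', rfl⟩ := exists_word hh
  rw [← hl, ← hk, ← List.prod_append, ← List.length_append]
  refine wlen_prod_le fun x hx => ?_
  rcases List.mem_append.1 hx with hx | hx
  exacts [hl' x hx, hk' x hx]

theorem wlen_inv_le (hg : g ∈ genF x0 x1) : wlen {x0, x1} g⁻¹ ≤ wlen {x0, x1} g := by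
  obtain ⟨l, hl, hl', rfl⟩ := exists_word hg
  rw [← hl, List.prod_inv_reverse]
  refine (wlen_prod_le fun x hx => ?_).trans (by simp)
  obtain ⟨y, hy, rfl⟩ := List.mem_map.1 (List.mem_reverse.1 hx)
  exact (hl' y hy).inv

theorem wlen_pow_le {x : VPerm} (hx : Letter x0 x1 x) (j : ℕ) : wlen {x0, x1} (x ^ j) ≤ j := by
  rw [← List.prod_replicate]
  refine (wlen_prod_le fun y hy => ?_).trans (by simp)
  rwa [List.eq_of_mem_replicate hy]

end WordLength

theorem app_replicate_succ (b : Bool) (j : ℕ) (ω : CSeq) :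
    app (List.replicate (j + 1) b) ω = cns b (app (List.replicate j b) ω) := by
  rw [List.replicate_succ, app_cons]

theorem replicate_not_inj {b : Bool} {j k : ℕ}
    (h : app (List.replicate j b) (fun _ => !b) = app (List.replicate k b) fun _ => !b) :
    j = k := by
  rcases lt_trichotomy j k with hjk | hjk | hjk
  · simpa [app, hjk] using congrFun h j
  · exact hjk
  · simpa [app, hjk] using congrFun h k

/-- On the cylinder of `b ^ j`, with `j ≥ J`, `g` replaces the prefix by `b ^ (j - s)`. -/
def Germ (b : Bool) (g : VPerm) (s : ℤ) (J : ℕ) : Prop :=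
  ∀ j : ℕ, J ≤ j → ∃ k : ℕ, (k : ℤ) = j - s ∧
    MapsPref g (List.replicate j b) (List.replicate k b)

/-- Near the constant sequence `b`, `g` removes `s` letters `b`. -/
def HasGerm (b : Bool) (g : VPerm) (s : ℤ) : Prop := ∃ J, Germ b g s J

section Germs

variable {b : Bool} {g h : VPerm} {s t : ℤ} {J : ℕ}

theorem Germ.mono (hg : Germ b g s J) {J' : ℕ} (hJ : J ≤ J') : Germ b g s J' :=
  fun j hj => hg j (hJ.trans hj)

theorem Germ.mul (hg : Germ b g s J) {J' : ℕ} (hh : Germ b h t J') (hJ : J + t ≤ J') :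
    Germ b (g * h) (s + t) J' := by
  intro j hj
  obtain ⟨k, hk, hk'⟩ := hh j hj
  obtain ⟨i, hi, hi'⟩ := hg k (by omega)
  exact ⟨i, by omega, fun ω => by rw [Equiv.Perm.mul_apply, hk', hi']⟩

theorem Germ.inv (hg : Germ b g s J) {J' : ℕ} (hJ : J ≤ J' + s) :
    Germ b g⁻¹ (-s) J' := by
  intro j hj
  obtain ⟨k, hk, hk'⟩ := hg (j + s).toNat (by omega)
  have hkj : k = j := by omega
  rw [hkj] at hk'
  exact ⟨(j + s).toNat, by omega, fun ω => by rw [Equiv.Perm.inv_eq_iff_eq, hk']⟩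

theorem Germ.one (b : Bool) (J : ℕ) : Germ b 1 0 J := fun j _ => ⟨j, by omega, fun _ => rfl⟩

theorem HasGerm.mul (hg : HasGerm b g s) (hh : HasGerm b h t) : HasGerm b (g * h) (s + t) := by
  obtain ⟨J, hg⟩ := hg
  obtain ⟨J', hh⟩ := hh
  exact ⟨J' + J + t.toNat, hg.mul (J' := J' + J + t.toNat) (hh.mono (by omega)) (by omega)⟩

theorem HasGerm.inv (hg : HasGerm b g s) : HasGerm b g⁻¹ (-s) := by
  obtain ⟨J, hg⟩ := hg
  exact ⟨J + s.natAbs, hg.inv (by omega)⟩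

theorem HasGerm.pow (hg : HasGerm b g s) (j : ℕ) : HasGerm b (g ^ j) (j * s) := by
  induction j with
  | zero => simpa using ⟨0, Germ.one b 0⟩
  | succ j ih => rw [pow_succ]; convert ih.mul hg using 1; push_cast; ring

theorem HasGerm.unique (hs : HasGerm b g s) (ht : HasGerm b g t) : s = t := by
  obtain ⟨J, hs⟩ := hs
  obtain ⟨J', ht⟩ := ht
  obtain ⟨k, hk, hk'⟩ := hs (J + J') (by omega)
  obtain ⟨i, hi, hi'⟩ := ht (J + J') (by omega)
  have := replicate_not_inj ((hk' fun _ => !b).symm.trans (hi' _))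
  omega

end Germs

namespace Gens

variable {x0 x1 g y : VPerm}

theorem germ_false_x0 (G : Gens x0 x1) : Germ false x0 1 2 := by
  intro j hj
  obtain ⟨j, rfl⟩ := Nat.exists_eq_add_of_le' hj
  exact ⟨j + 1, by push_cast; ring, fun ω => by simp only [app_replicate_succ, G.x0_ff]⟩

theorem germ_true_x0 (G : Gens x0 x1) : Germ true x0 (-1) 1 := by
  intro j hj
  obtain ⟨j, rfl⟩ := Nat.exists_eq_add_of_le' hj
  exact ⟨j + 2, by push_cast; ring, fun ω => by simp only [app_replicate_succ, G.x0_t]⟩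

theorem germ_false_x1 (G : Gens x0 x1) : Germ false x1 0 1 := by
  intro j hj
  obtain ⟨j, rfl⟩ := Nat.exists_eq_add_of_le' hj
  exact ⟨j + 1, by push_cast; ring, fun ω => by simp only [app_replicate_succ, G.x1_f]⟩

theorem germ_true_x1 (G : Gens x0 x1) : Germ true x1 (-1) 2 := by
  intro j hj
  obtain ⟨j, rfl⟩ := Nat.exists_eq_add_of_le' hj
  exact ⟨j + 3, by push_cast; ring, fun ω => by
    simp only [app_replicate_succ, G.x1_t, G.x0_t]⟩

theorem exists_germ_letter (G : Gens x0 x1) (b : Bool) {x : VPerm} (hx : Letter x0 x1 x) :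
    ∃ s : ℤ, |s| ≤ 1 ∧ Germ b x s 3 := by
  rcases hx with rfl | rfl | rfl | rfl <;> cases b
  · exact ⟨1, by simp, G.germ_false_x0.mono (by simp)⟩
  · exact ⟨-1, by simp, G.germ_true_x0.mono (by simp)⟩
  · exact ⟨_, by simp, G.germ_false_x0.inv (by simp)⟩
  · exact ⟨_, by simp, G.germ_true_x0.inv (by simp)⟩
  · exact ⟨0, by simp, G.germ_false_x1.mono (by simp)⟩
  · exact ⟨-1, by simp, G.germ_true_x1.mono (by simp)⟩
  · exact ⟨_, by simp, G.germ_false_x1.inv (by simp)⟩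
  · exact ⟨_, by simp, G.germ_true_x1.inv (by simp)⟩

theorem exists_germ_prod (G : Gens x0 x1) (b : Bool) {l : List VPerm}
    (hl : ∀ x ∈ l, Letter x0 x1 x) :
    ∃ s : ℤ, |s| ≤ l.length ∧ Germ b l.prod s (l.length + 2) := by
  induction l with
  | nil => exact ⟨0, by simp, Germ.one b _⟩
  | cons x l ih =>
    obtain ⟨s, hs, hs'⟩ := ih fun y hy => hl y (List.mem_cons_of_mem _ hy)
    obtain ⟨t, ht, ht'⟩ := G.exists_germ_letter b (hl x (by simp))
    rw [abs_le] at hs ht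
    rw [List.prod_cons, List.length_cons]
    exact ⟨t + s, by rw [abs_le]; push_cast; omega,
      ht'.mul (hs'.mono (by omega)) (by push_cast; omega)⟩

theorem exists_germ (G : Gens x0 x1) (b : Bool) (hg : g ∈ genF x0 x1) :
    ∃ s : ℤ, |s| ≤ wlen {x0, x1} g ∧ Germ b g s (wlen {x0, x1} g + 2) := by
  obtain ⟨l, hl, hl', rfl⟩ := exists_word hg
  rw [← hl]
  exact G.exists_germ_prod b hl'

theorem abs_germ_le (G : Gens x0 x1) {b : Bool} {s : ℤ} (hg : g ∈ genF x0 x1)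
    (hs : HasGerm b g s) : |s| ≤ wlen {x0, x1} g := by
  obtain ⟨t, ht, ht'⟩ := G.exists_germ b hg
  rwa [hs.unique ⟨_, ht'⟩]

theorem le_wlen_of_isCopy (G : Gens x0 x1) {j : ℕ} (hy : y ∈ genF x0 x1)
    (hc : IsCopy x0 (List.replicate j false) y) : j ≤ wlen {x0, x1} y + 1 := by
  by_contra! hlt
  obtain ⟨s, -, hs⟩ := G.exists_germ false hy
  obtain ⟨k, -, hk⟩ := hs j (by omega)
  have h1 := fun ω => (hc.1 ω).symm.trans (hk ω)
  have hct : (fun _ => true : CSeq) = cns true fun _ => true := by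
    funext n; cases n <;> simp [cns_zero, cns_succ]
  have hfix : x0 (fun _ => true) = fun _ => true := by
    rw [hct, G.x0_t, ← hct, ← hct]
  obtain rfl : j = k := by
    refine replicate_not_inj (b := false) ?_
    simpa only [Bool.not_false, hfix] using h1 fun _ => true
  have h2 := app_injective _ (h1 (cns false (cns true fun _ => true)))
  rw [G.x0_ft, cns_inj] at h2
  exact absurd h2.1 (by simp)

end Gens

section Copies

variable {h g y y' : VPerm} {u v : List Bool}

theorem IsCopy.eq (hy : IsCopy h u y) (hy' : IsCopy h u y') : y = y' := by
  ext1 ω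
  by_cases hω : IsPref u ω
  · obtain ⟨ω, rfl⟩ := hω
    rw [hy.1, hy'.1]
  · rw [hy.2 ω hω, hy'.2 ω hω]

theorem IsCopy.conj (hy : IsCopy h u y) (hg : MapsPref g u v) :
    IsCopy h v (g * y * g⁻¹) := by
  refine ⟨fun ω => ?_, fun ω hω => ?_⟩
  · rw [Equiv.Perm.mul_apply, Equiv.Perm.mul_apply, ← hg, perm_inv_apply_apply, hy.1, hg]
  · rw [Equiv.Perm.mul_apply, Equiv.Perm.mul_apply, hy.2, perm_apply_inv_apply]
    rintro ⟨ω', h'⟩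
    exact hω ⟨ω', by rw [← hg, ← h', perm_apply_inv_apply]⟩

theorem IsCopy.mul_eq_mul (hy : IsCopy h u y) (hg : MapsPref g u v) (hy' : IsCopy h v y') :
    y' * g = g * y := by
  rw [hy'.eq (hy.conj hg), inv_mul_cancel_right]

end Copies

/-- The copy of `x0` supported on the cylinder of `0 ^ p`, for `p ≥ 1`. -/
def deepCopy (x0 x1 : VPerm) (p : ℕ) : VPerm := x0⁻¹ ^ p * x1⁻¹ * x0 ^ (p + 1)

theorem deepCopy_mem (x0 x1 : VPerm) (p : ℕ) : deepCopy x0 x1 p ∈ genF x0 x1 :=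
  mul_mem (mul_mem (pow_mem (inv_mem (x0_mem_genF _ _)) _) (inv_mem (x1_mem_genF _ _)))
    (pow_mem (x0_mem_genF _ _) _)

theorem Gens.isCopy_deepCopy {x0 x1 : VPerm} (G : Gens x0 x1) {p : ℕ} (hp : 1 ≤ p) :
    IsCopy x0 (List.replicate p false) (deepCopy x0 x1 p) := by
  induction p, hp using Nat.le_induction with
  | base =>
    obtain ⟨h1, h2⟩ := G.actsBelow_false_x0
    have he : deepCopy x0 x1 1 = x0⁻¹ * x1⁻¹ * x0 * x0 := by
      rw [deepCopy, pow_one, pow_two, ← mul_assoc]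
    rw [he]
    refine ⟨h1, fun ω hω => ?_⟩
    obtain ⟨b, ω, rfl⟩ := exists_cns ω
    cases b
    · exact absurd ⟨ω, rfl⟩ hω
    · exact h2 ω
  | succ p hp ih =>
    have he : deepCopy x0 x1 (p + 1) = x0⁻¹ * deepCopy x0 x1 p * x0⁻¹⁻¹ := by
      rw [deepCopy, deepCopy, pow_succ' x0⁻¹, pow_succ x0 (p + 1), inv_inv]
      simp only [mul_assoc]
    rw [he]
    refine ih.conj fun ω => ?_
    obtain ⟨p, rfl⟩ := Nat.exists_eq_add_of_le' hp
    simp only [app_replicate_succ, G.x0_inv_f]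

theorem wordEval_append (g : VPerm) (w v : List VPerm) :
    wordEval g (w ++ v) = wordEval (wordEval g w) v := List.foldl_append

/-- There is a word of length at most `len` leading from `g` to `h` in the Cayley graph, all of
whose vertices `k` satisfy `|k| > n / 8`. -/
def FarPath (x0 x1 : VPerm) (n : ℕ) (g h : VPerm) (len : ℕ) : Prop :=
  ∃ w : List VPerm, (∀ x ∈ w, Letter x0 x1 x) ∧ w.length ≤ len ∧ wordEval g w = h ∧
    ∀ w' : List VPerm, w' <+: w → n < 8 * wlen {x0, x1} (wordEval g w')

namespace FarPath

variable {x0 x1 g h k x : VPerm} {n a b : ℕ}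

theorem refl (hg : n < 8 * wlen {x0, x1} g) : FarPath x0 x1 n g g 0 :=
  ⟨[], by simp, le_rfl, rfl, fun w' hw' => by rw [List.prefix_nil.1 hw']; exact hg⟩

theorem trans (hgh : FarPath x0 x1 n g h a) (hhk : FarPath x0 x1 n h k b) :
    FarPath x0 x1 n g k (a + b) := by
  obtain ⟨w, hw, hwa, rfl, hw'⟩ := hgh
  obtain ⟨v, hv, hvb, rfl, hv'⟩ := hhk
  refine ⟨w ++ v, fun x hx => ?_, by simp; omega, wordEval_append g w v, fun p hp => ?_⟩
  · rcases List.mem_append.1 hx with hx | hx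
    exacts [hw x hx, hv x hx]
  · rcases List.prefix_or_prefix_of_prefix hp (List.prefix_append w v) with hp | hp
    · exact hw' p hp
    · obtain ⟨q, rfl⟩ := hp
      rw [List.prefix_append_right_inj] at hp
      have := hv' q hp
      rwa [← wordEval_append] at this

theorem step (hx : Letter x0 x1 x) (hg : n < 8 * wlen {x0, x1} g)
    (hxg : n < 8 * wlen {x0, x1} (x * g)) : FarPath x0 x1 n g (x * g) 1 := by
  refine ⟨[x], by simpa using hx, le_rfl, rfl, fun p hp => ?_⟩
  rcases List.prefix_cons_iff.1 hp with rfl | ⟨q, rfl, hq⟩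
  · exact hg
  · rw [List.prefix_nil.1 hq]
    exact hxg

theorem pow (hx : Letter x0 x1 x) {J : ℕ} (hJ : ∀ j ≤ J, n < 8 * wlen {x0, x1} (x ^ j * g)) :
    FarPath x0 x1 n g (x ^ J * g) J := by
  induction J with
  | zero => simpa using refl (by simpa using hJ 0 le_rfl)
  | succ J ih =>
    have h1 := hJ (J + 1) le_rfl
    rw [pow_succ', mul_assoc] at *
    exact (ih fun j hj => hJ j (by omega)).trans (step hx (hJ J (by omega)) h1)

theorem strip {y : VPerm} {l : List VPerm} (hl : ∀ x ∈ l, Letter x0 x1 x)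
    (H : ∀ l' : List VPerm, (∀ x ∈ l', Letter x0 x1 x) → l'.length ≤ l.length →
      n < 8 * wlen {x0, x1} (l'.prod * y)) :
    FarPath x0 x1 n (l.prod * y) y l.length := by
  induction l with
  | nil => simpa using refl (by simpa using H [] (by simp))
  | cons x l ih =>
    have hl' : ∀ y ∈ l, Letter x0 x1 y := fun y hy => hl y (List.mem_cons_of_mem _ hy)
    have he : x⁻¹ * ((x :: l).prod * y) = l.prod * y := by
      rw [List.prod_cons, mul_assoc, inv_mul_cancel_left]
    have hs := step (hl x (by simp)).inv (H _ hl le_rfl) (by rw [he]; exact H _ hl' (by simp))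
    rw [he] at hs
    have := hs.trans (ih hl' fun l' h1 h2 => H l' h1 (by simp; omega))
    rwa [Nat.add_comm, ← List.length_cons (a := x)] at this

end FarPath

theorem nbr_one_le : Nbr 1 ≤ 1 := by
  refine Nat.sInf_le ⟨{([], [])}, ⟨?_, ?_, ?_⟩, ?_, rfl⟩
  · exact fun ω => ⟨([], []), ⟨by simp, ω, (app_nil ω).symm⟩, by simp⟩
  · exact fun ω => ⟨([], []), ⟨by simp, ω, (app_nil ω).symm⟩, by simp⟩
  · simp
  · intro u v h
    simp at h

namespace Gens

variable {x0 x1 g : VPerm}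

theorem path_strip (G : Gens x0 x1) (hg : g ∈ genF x0 x1) {n p : ℕ}
    (hn : wlen {x0, x1} g = n) (hn1 : 1 ≤ n) (hp : p + 1 = 10 * n) :
    FarPath x0 x1 n (g * deepCopy x0 x1 p) (deepCopy x0 x1 p) n := by
  have hY := G.le_wlen_of_isCopy (deepCopy_mem x0 x1 p) (G.isCopy_deepCopy (by omega))
  obtain ⟨l, hl, hl', rfl⟩ := exists_word hg
  have := FarPath.strip (n := n) (y := deepCopy x0 x1 p) hl' fun l' h1 h2 => by
    have hm : l'.prod ∈ genF x0 x1 := list_prod_mem fun x hx => by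
      rcases h1 x hx with rfl | rfl | rfl | rfl
      exacts [x0_mem_genF _ _, inv_mem (x0_mem_genF _ _), x1_mem_genF _ _,
        inv_mem (x1_mem_genF _ _)]
    have h3 := wlen_mul_le (inv_mem hm) (mul_mem hm (deepCopy_mem x0 x1 p))
    rw [inv_mul_cancel_left] at h3
    have h4 := wlen_inv_le hm
    have h5 := wlen_prod_le h1
    omega
  rwa [hl, hn] at this

/-- The part of the path that uses `x0` only, when `g` does not contract too strongly at `0`. -/
theorem path_of_germ_ge (G : Gens x0 x1) (hg : g ∈ genF x0 x1) {n p k : ℕ} {s : ℤ}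
    (hn : wlen {x0, x1} g = n) (hn1 : 1 ≤ n) (hp : p + 1 = 10 * n)
    (hs : HasGerm false g s) (hk : (k : ℤ) = p - s)
    (hcomm : deepCopy x0 x1 k * g = g * deepCopy x0 x1 p) (hsge : -(n : ℤ) ≤ 4 * s) :
    FarPath x0 x1 n g (g * deepCopy x0 x1 p) (2 * k + 2) := by
  have m0 := x0_mem_genF x0 x1
  have m1 := x1_mem_genF x0 x1
  have l0 : Letter x0 x1 x0 := .inl rfl
  have l1 : Letter x0 x1 x1 := .inr (.inr (.inl rfl))
  have g0 : HasGerm false x0 1 := ⟨_, G.germ_false_x0⟩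
  have g1 : HasGerm false x1 0 := ⟨_, G.germ_false_x1⟩
  have hY := G.le_wlen_of_isCopy (deepCopy_mem x0 x1 p) (G.isCopy_deepCopy (by omega))
  have up : ∀ j : ℕ, n < 8 * wlen {x0, x1} (x0 ^ j * g) := fun j => by
    have hm := mul_mem (pow_mem m0 j) hg
    have h1 := (le_abs_self _).trans (G.abs_germ_le hm ((g0.pow j).mul hs))
    have h2 := wlen_mul_le (inv_mem (pow_mem m0 j)) hm
    have h3 := wlen_inv_le (pow_mem m0 j)
    have h4 := wlen_pow_le l0 j
    rw [inv_mul_cancel_left] at h2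
    omega
  have down : ∀ j ≤ k,
      n < 8 * wlen {x0, x1} (x0⁻¹ ^ j * (x1⁻¹ * (x0 ^ (k + 1) * g))) := fun j hj => by
    have hm := mul_mem (pow_mem (inv_mem m0) j)
      (mul_mem (inv_mem m1) (mul_mem (pow_mem m0 (k + 1)) hg))
    have h1 := (le_abs_self _).trans (G.abs_germ_le hm
      ((g0.inv.pow j).mul (g1.inv.mul ((g0.pow (k + 1)).mul hs))))
    have he : deepCopy x0 x1 p =
        g⁻¹ * (x0⁻¹ ^ (k - j) * (x0⁻¹ ^ j * (x1⁻¹ * (x0 ^ (k + 1) * g)))) := by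
      rw [← mul_assoc (x0⁻¹ ^ (k - j)), ← pow_add, Nat.sub_add_cancel hj, ← mul_assoc x1⁻¹,
        ← mul_assoc (x0⁻¹ ^ k), ← mul_assoc (x0⁻¹ ^ k), ← deepCopy, hcomm, inv_mul_cancel_left]
    have h2 := wlen_mul_le (inv_mem hg) (mul_mem (pow_mem (inv_mem m0) (k - j)) hm)
    have h3 := wlen_mul_le (pow_mem (inv_mem m0) (k - j)) hm
    have h4 := wlen_pow_le l0.inv (k - j)
    have h5 := wlen_inv_le hg
    rw [← he] at h2
    push_cast at h1
    omega
  have := ((FarPath.pow l0 fun j _ => up j).trans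
    (FarPath.step l1.inv (up (k + 1)) (by simpa using down 0 (by omega)))).trans
    (FarPath.pow l0.inv down)
  convert this using 1
  · rw [← hcomm, deepCopy]; simp only [mul_assoc]
  · ring

/-- The same, with a detour along powers of `x1`, when `g` contracts strongly at `0`. -/
theorem path_of_germ_lt (G : Gens x0 x1) (hg : g ∈ genF x0 x1) {n p k : ℕ} {s t : ℤ}
    (hn : wlen {x0, x1} g = n) (hn1 : 1 ≤ n) (hp : p + 1 = 10 * n)
    (hs : HasGerm false g s) (ht : HasGerm true g t) (htn : |t| ≤ n) (hk : 1 ≤ k)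
    (hcomm : deepCopy x0 x1 k * g = g * deepCopy x0 x1 p) (hslt : 4 * s < -(n : ℤ)) :
    FarPath x0 x1 n g (g * deepCopy x0 x1 p) (2 * k + 2 + 4 * n) := by
  have m0 := x0_mem_genF x0 x1
  have m1 := x1_mem_genF x0 x1
  have l0 : Letter x0 x1 x0 := .inl rfl
  have l1 : Letter x0 x1 x1 := .inr (.inr (.inl rfl))
  have f1 : HasGerm false x1 0 := ⟨_, G.germ_false_x1⟩
  have g0 : HasGerm true x0 (-1) := ⟨_, G.germ_true_x0⟩
  have g1 : HasGerm true x1 (-1) := ⟨_, G.germ_true_x1⟩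
  have hY := G.le_wlen_of_isCopy (deepCopy_mem x0 x1 p) (G.isCopy_deepCopy (by omega))
  rw [abs_le] at htn
  have out : ∀ i : ℕ, n < 8 * wlen {x0, x1} (x1 ^ i * g) := fun i => by
    have h1 := (neg_le_abs _).trans
      (G.abs_germ_le (mul_mem (pow_mem m1 i) hg) ((f1.pow i).mul hs))
    omega
  have mq := mul_mem (pow_mem m1 (2 * n)) hg
  have gq := (g1.pow (2 * n)).mul ht
  set q := x1 ^ (2 * n) * g with hq
  have up : ∀ j : ℕ, n < 8 * wlen {x0, x1} (x0 ^ j * q) := fun j => by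
    have h1 := (neg_le_abs _).trans (G.abs_germ_le (mul_mem (pow_mem m0 j) mq) ((g0.pow j).mul gq))
    push_cast at h1
    omega
  have down : ∀ j ≤ k,
      n < 8 * wlen {x0, x1} (x0⁻¹ ^ j * (x1⁻¹ * (x0 ^ (k + 1) * q))) := fun j hj => by
    have h1 := (neg_le_abs _).trans (G.abs_germ_le
      (mul_mem (pow_mem (inv_mem m0) j) (mul_mem (inv_mem m1) (mul_mem (pow_mem m0 (k + 1)) mq)))
      ((g0.inv.pow j).mul (g1.inv.mul ((g0.pow (k + 1)).mul gq))))
    push_cast at h1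
    omega
  have mY := mul_mem hg (deepCopy_mem x0 x1 p)
  have back : ∀ i ≤ 2 * n, n < 8 * wlen {x0, x1}
      (x1⁻¹ ^ i * (x1 ^ (2 * n) * (g * deepCopy x0 x1 p))) := fun i hi => by
    have he : x1⁻¹ ^ i * (x1 ^ (2 * n) * (g * deepCopy x0 x1 p)) =
        x1 ^ (2 * n - i) * (g * deepCopy x0 x1 p) := by
      obtain ⟨c, hc⟩ := Nat.exists_eq_add_of_le hi
      rw [hc, pow_add, inv_pow, mul_assoc, inv_mul_cancel_left, Nat.add_sub_cancel_left]
    have mx := pow_mem m1 (2 * n - i)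
    have h1 := wlen_mul_le (inv_mem hg) mY
    have h2 := wlen_mul_le (inv_mem mx) (mul_mem mx mY)
    have h3 := wlen_inv_le mx
    have h4 := wlen_pow_le l1 (2 * n - i)
    have h5 := wlen_inv_le hg
    rw [inv_mul_cancel_left] at h1 h2
    rw [he]
    omega
  have hfix : MapsPref (x1 ^ (2 * n)) (List.replicate k false) (List.replicate k false) := by
    intro ω
    obtain ⟨k, rfl⟩ := Nat.exists_eq_add_of_le' hk
    rw [app_replicate_succ]
    exact Function.IsFixedPt.perm_pow (G.x1_f _) (2 * n)
  have hc := (G.isCopy_deepCopy hk).mul_eq_mul hfix (G.isCopy_deepCopy hk)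
  have he : x0⁻¹ ^ k * (x1⁻¹ * (x0 ^ (k + 1) * q)) =
      x1 ^ (2 * n) * (g * deepCopy x0 x1 p) := by
    rw [← hcomm, ← mul_assoc (x1 ^ (2 * n)), ← hc, deepCopy, hq]
    simp only [mul_assoc]
  have loop := ((FarPath.pow l0 fun j _ => up j).trans
    (FarPath.step l1.inv (up (k + 1)) (by simpa using down 0 (by omega)))).trans
    (FarPath.pow l0.inv down)
  rw [he] at loop
  have := ((FarPath.pow l1 fun i _ => out i).trans loop).trans (FarPath.pow l1.inv back)
  convert this using 1
  · rw [inv_pow, inv_mul_cancel_left]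
  · ring

theorem exists_path (G : Gens x0 x1) (hg : g ∈ genF x0 x1) {n p : ℕ}
    (hn : wlen {x0, x1} g = n) (hn1 : 1 ≤ n) (hp : p + 1 = 10 * n) :
    FarPath x0 x1 n g (deepCopy x0 x1 p) (27 * n) := by
  obtain ⟨s, hsn, hs⟩ := G.exists_germ false hg
  obtain ⟨t, htn, ht⟩ := G.exists_germ true hg
  rw [hn] at hsn htn hs
  obtain ⟨k, hk, hmap⟩ := hs p (by omega)
  have hsn' := abs_le.1 hsn
  have hcomm := (G.isCopy_deepCopy (p := p) (by omega)).mul_eq_mul hmap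
    (G.isCopy_deepCopy (by omega))
  have main : FarPath x0 x1 n g (g * deepCopy x0 x1 p) (2 * k + 2 + 4 * n) := by
    rcases le_or_gt (-(n : ℤ)) (4 * s) with h | h
    · obtain ⟨w, h1, h2, h3⟩ := G.path_of_germ_ge hg hn hn1 hp ⟨_, hs⟩ hk hcomm h
      exact ⟨w, h1, by omega, h3⟩
    · exact G.path_of_germ_lt hg hn hn1 hp ⟨_, hs⟩ ⟨_, ht⟩ htn (by omega) hcomm h
  obtain ⟨w, h1, h2, h3⟩ := main.trans (G.path_strip hg hn hn1 hp)
  exact ⟨w, h1, by omega, h3⟩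

end Gens

/-- There exist `δ, D > 0` and a positive integer `Q` such
that for every `g ∈ F` with `N(g) ≥ 4` there is a word `w` in the letters
`x0^{±1}, x1^{±1}` of length at most `D·|g|_A`, with
`g·w = x0^{Q|g|_A}·x1^{−1}·x0^{−Q|g|_A+1}` (left-to-right products), and
`|g·w'|_A > δ·|g|_A` for every prefix `w'` of `w`. -/
theorem stmt14 (x0 x1 : VPerm)
    (hx0 : Represents x0 x0T) (hx1 : Represents x1 x1T) :
    ∃ δ D : ℝ, ∃ Q : ℕ, 0 < δ ∧ 0 < D ∧ 0 < Q ∧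
      ∀ g : VPerm, InF g → 4 ≤ Nbr g →
        ∃ w : List VPerm,
          (∀ x ∈ w, x = x0 ∨ x = x0⁻¹ ∨ x = x1 ∨ x = x1⁻¹) ∧
          (w.length : ℝ) ≤ D * (wlen {x0, x1} g : ℝ) ∧
          wordEval g w =
            x0 ^ (1 - ((Q * wlen {x0, x1} g : ℕ) : ℤ)) * x1⁻¹ *
              x0 ^ (Q * wlen {x0, x1} g) ∧
          (∀ w' : List VPerm, w' <+: w →
            δ * (wlen {x0, x1} g : ℝ) < (wlen {x0, x1} (wordEval g w') : ℝ)) := by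
  have G := gens_of_represents hx0 hx1
  refine ⟨1 / 8, 27, 10, by norm_num, by norm_num, by norm_num, fun g hg hN => ?_⟩
  have hmem := mem_genF G hg
  have hn1 : 1 ≤ wlen {x0, x1} g := by
    by_contra! h0
    obtain ⟨l, hl, -, rfl⟩ := exists_word hmem
    rw [Nat.lt_one_iff.1 h0, List.length_eq_zero_iff] at hl
    have := nbr_one_le
    rw [hl, List.prod_nil] at hN
    omega
  generalize hn : wlen {x0, x1} g = n at *
  obtain ⟨w, hw, hlen, he, hpre⟩ := G.exists_path (p := 10 * n - 1) hmem hn hn1 (by omega)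
  refine ⟨w, hw, by exact_mod_cast hlen, ?_, fun w' hw' => ?_⟩
  · have h1 : (1 : ℤ) - ((10 * n : ℕ) : ℤ) = -((10 * n - 1 : ℕ) : ℤ) := by omega
    rw [he, deepCopy, h1, zpow_neg, zpow_natCast, inv_pow, Nat.sub_add_cancel (by omega)]
  · have h1 : (n : ℝ) < 8 * wlen {x0, x1} (wordEval g w') := by exact_mod_cast hpre w' hw'
    linarith
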